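/- arXiv:2007.10758 — 9 statements merged into one kernel-verified Lean document; each statement's English description precedes it below -/
import Mathlib

section
/- Fix an integer n ≥ 1 and positive reals R⁰ and kⁱ, Rⁱ, σⁱ (i = 1,…,n), with R̃ⁱ := kⁱ + Rⁱ(σⁱ)². Let z > 0 and set γ⋆ := −R⁰z³. Then (z,γ⋆) satisfies R̃ⁱz − (σⁱ)²γ⋆ > 0 for all i, and γ⋆ is the strict global maximizer of γ ↦ Σ_{i=1}^n h^{i,b}(z,γ) over {γ ∈ ℝ : R̃ⁱz − (σⁱ)²γ > 0 for all i}: for every admissible γ ≠ γ⋆ one has Σ_{i=1}^n h^{i,b}(z,γ) < Σ_{i=1}^n h^{i,b}(z,γ⋆). (Proposition 2.3(i): the principal's optimal quadratic-variation payment rate is Γᵇ = −R⁰z³.) -/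
/-- A strictly concave quadratic payoff is strictly maximized at its critical point. -/
lemma quadratic_payoff_lt_of_critical {k r a y y' : ℝ} (hra : 0 < r + a)
    (hcrit : (r + a) * y' = k + a) (hne : y ≠ y') :
    k * y - r / 2 * y ^ 2 - a / 2 * (1 - y) ^ 2
      < k * y' - r / 2 * y' ^ 2 - a / 2 * (1 - y') ^ 2 := by
  have hpos : 0 < (r + a) * (y - y') ^ 2 :=
    mul_pos hra (sq_pos_of_ne_zero (sub_ne_zero.mpr hne))
  have hk : k = (r + a) * y' - a := by linarith
  subst hk
  nlinarith

/-- Proposition 2.3(i): for `z > 0`, the principal's optimal quadratic-variation payment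
rate is `γ⋆ = −R⁰z³`: it is admissible (`R̃ⁱz − (σⁱ)²γ⋆ > 0` for all `i`) and is the
strict global maximizer of `γ ↦ Σᵢ h^{i,b}(z,γ)` over the admissible set. -/
theorem optimal_gamma_strict_max
    (n : ℕ) (hn : 1 ≤ n) (R0 : ℝ) (hR0 : 0 < R0)
    (k R σ : Fin n → ℝ)
    (hk : ∀ i, 0 < k i) (hR : ∀ i, 0 < R i) (hσ : ∀ i, 0 < σ i)
    (z : ℝ) (hz : 0 < z)
    (zib : ℝ → ℝ → Fin n → ℝ)
    (hzib : ∀ zz g i, zib zz g i = (k i * zz - (σ i) ^ 2 * g)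
        / ((k i + R i * (σ i) ^ 2) * zz - (σ i) ^ 2 * g))
    (hib : ℝ → ℝ → Fin n → ℝ)
    (hhib : ∀ zz g i, hib zz g i = k i * zib zz g i
        - (k i + R i * (σ i) ^ 2) / 2 * (zib zz g i) ^ 2
        - R0 / 2 * (σ i) ^ 2 * zz ^ 2 * (1 - zib zz g i) ^ 2) :
    (∀ i, (k i + R i * (σ i) ^ 2) * z - (σ i) ^ 2 * (-R0 * z ^ 3) > 0)
    ∧ ∀ γ : ℝ, (∀ i, (k i + R i * (σ i) ^ 2) * z - (σ i) ^ 2 * γ > 0) →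
        γ ≠ -R0 * z ^ 3 →
        ∑ i, hib z γ i < ∑ i, hib z (-R0 * z ^ 3) i := by
  have hadm : ∀ i, (k i + R i * (σ i) ^ 2) * z - (σ i) ^ 2 * (-R0 * z ^ 3) > 0 := by
    intro i
    have := hk i
    have := hR i
    have := hσ i
    have : 0 < (k i + R i * (σ i) ^ 2) * z + (σ i) ^ 2 * (R0 * z ^ 3) := by positivity
    linarith
  refine ⟨hadm, fun γ hγ hne => Finset.sum_lt_sum_of_nonempty ⟨⟨0, hn⟩, Finset.mem_univ _⟩ ?_⟩
  intro i _
  have hki := hk i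
  have hRi := hR i
  have hσi := hσ i
  have hra : 0 < (k i + R i * (σ i) ^ 2) + R0 * (σ i) ^ 2 * z ^ 2 := by positivity
  have hcrit : ((k i + R i * (σ i) ^ 2) + R0 * (σ i) ^ 2 * z ^ 2) * zib z (-R0 * z ^ 3) i
      = k i + R0 * (σ i) ^ 2 * z ^ 2 := by
    rw [hzib, ← mul_div_assoc, div_eq_iff (hadm i).ne']
    ring
  have hzne : zib z γ i ≠ zib z (-R0 * z ^ 3) i := by
    rw [hzib, hzib, Ne, div_eq_div_iff (hγ i).ne' (hadm i).ne']
    intro h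
    have hprod : (R i * (σ i) ^ 4 * z) * (γ - -R0 * z ^ 3) = 0 := by linear_combination -h
    have hc : R i * (σ i) ^ 4 * z ≠ 0 := by positivity
    exact hne (sub_eq_zero.mp ((mul_eq_zero.mp hprod).resolve_left hc))
  have hlt := quadratic_payoff_lt_of_critical hra hcrit hzne
  rw [hhib, hhib]
  linarith
end

section
/- Fix an integer n ≥ 1 and positive reals R⁰ and kⁱ, Rⁱ, σⁱ (i = 1,…,n), with R̃ⁱ := kⁱ + Rⁱ(σⁱ)². For every z > 0 with z ≠ 1, one has Σ_{i=1}^n h^{i,b}(z, −R⁰z²) < Σ_{i=1}^n h^{i,b}(z, −R⁰z³); both points (z,−R⁰z²) and (z,−R⁰z³) satisfy R̃ⁱz − (σⁱ)²γ > 0 for all i. (Non-optimality of linear contracts in continuous time, Section 2.3.1: Sung's linear contract corresponds to the forced choice Γ = −R⁰z², which yields a strictly smaller principal's objective than the optimal choice Γ = −R⁰z³.) -/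
/-- A strictly concave quadratic `k p - K p² / 2 - c (1 - p)² / 2` is strictly below its value at
its critical point `q`, characterized by `(K + c) q = k + c`. -/
lemma quadratic_lt_of_critical {k K c p q : ℝ} (hKc : 0 < K + c) (hq : (K + c) * q = k + c)
    (hpq : p ≠ q) :
    k * p - K / 2 * p ^ 2 - c / 2 * (1 - p) ^ 2 < k * q - K / 2 * q ^ 2 - c / 2 * (1 - q) ^ 2 := by
  have hpos : 0 < (K + c) * (p - q) ^ 2 :=
    mul_pos hKc (sq_pos_iff.mpr (sub_ne_zero.mpr hpq))
  obtain rfl : k = (K + c) * q - c := by linarith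
  linarith

/-- For `r ≠ 0`, the map `x ↦ (a + x) / (a + r + x)` is injective where it is defined. -/
lemma add_div_add_ne {a r x y : ℝ} (hr : r ≠ 0) (hx : a + r + x ≠ 0) (hy : a + r + y ≠ 0)
    (hxy : x ≠ y) : (a + x) / (a + r + x) ≠ (a + y) / (a + r + y) := by
  rw [Ne, div_eq_div_iff hx hy]
  intro h
  exact hxy (mul_left_cancel₀ hr (by linarith))

/-- Non-optimality of linear contracts (Section 2.3.1): for every `z > 0` with `z ≠ 1`,
Sung's linear contract choice `γ = −R⁰z²` yields a strictly smaller value of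
`Σᵢ h^{i,b}(z,·)` than the optimal choice `γ = −R⁰z³`; both choices are admissible. -/
theorem linear_contract_suboptimal
    (n : ℕ) (hn : 1 ≤ n) (R0 : ℝ) (hR0 : 0 < R0)
    (k R σ : Fin n → ℝ)
    (hk : ∀ i, 0 < k i) (hR : ∀ i, 0 < R i) (hσ : ∀ i, 0 < σ i)
    (z : ℝ) (hz : 0 < z) (hz1 : z ≠ 1)
    (zib : ℝ → ℝ → Fin n → ℝ)
    (hzib : ∀ zz g i, zib zz g i = (k i * zz - (σ i) ^ 2 * g)
        / ((k i + R i * (σ i) ^ 2) * zz - (σ i) ^ 2 * g))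
    (hib : ℝ → ℝ → Fin n → ℝ)
    (hhib : ∀ zz g i, hib zz g i = k i * zib zz g i
        - (k i + R i * (σ i) ^ 2) / 2 * (zib zz g i) ^ 2
        - R0 / 2 * (σ i) ^ 2 * zz ^ 2 * (1 - zib zz g i) ^ 2) :
    (∀ i, (k i + R i * (σ i) ^ 2) * z - (σ i) ^ 2 * (-R0 * z ^ 2) > 0)
    ∧ (∀ i, (k i + R i * (σ i) ^ 2) * z - (σ i) ^ 2 * (-R0 * z ^ 3) > 0)
    ∧ ∑ i, hib z (-R0 * z ^ 2) i < ∑ i, hib z (-R0 * z ^ 3) i := by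
  have hden : ∀ i (m : ℕ), 0 < (k i + R i * (σ i) ^ 2) * z - (σ i) ^ 2 * (-R0 * z ^ m) := by
    intro i m
    have := hk i
    have := hR i
    have := hσ i
    have h : 0 < (k i + R i * (σ i) ^ 2) * z + (σ i) ^ 2 * (R0 * z ^ m) := by positivity
    linarith
  refine ⟨fun i => hden i 2, fun i => hden i 3, ?_⟩
  refine Finset.sum_lt_sum_of_nonempty ⟨⟨0, hn⟩, Finset.mem_univ _⟩ fun i _ => ?_
  have hki := hk i
  have hRi := hR i
  have hσi := hσ i
  have hne : zib z (-R0 * z ^ 2) i ≠ zib z (-R0 * z ^ 3) i := by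
    have hx := hden i 2
    have hy := hden i 3
    have hxy : -((σ i) ^ 2 * (-R0 * z ^ 2)) ≠ -((σ i) ^ 2 * (-R0 * z ^ 3)) := by
      intro h
      have hc : (σ i) ^ 2 * R0 * z ^ 2 ≠ 0 := by positivity
      exact hz1 (mul_left_cancel₀ hc (by linarith))
    rw [hzib, hzib]
    simp only [add_mul (k i), sub_eq_add_neg] at hx hy ⊢
    exact add_div_add_ne (by positivity) hx.ne' hy.ne' hxy
  have hcrit : (k i + R i * (σ i) ^ 2 + R0 * (σ i) ^ 2 * z ^ 2) * zib z (-R0 * z ^ 3) i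
      = k i + R0 * (σ i) ^ 2 * z ^ 2 := by
    have h := hzib z (-R0 * z ^ 3) i
    rw [eq_div_iff (hden i 3).ne'] at h
    exact mul_left_cancel₀ hz.ne' (by linarith)
  have key := quadratic_lt_of_critical (by positivity) hcrit hne
  rw [hhib, hhib]
  linarith
end

section
/- Fix an integer n ≥ 1 and positive reals k⁰, R⁰, σ⁰ and kⁱ, Rⁱ, σⁱ (i = 1,…,n), with R̃ⁱ := kⁱ + Rⁱ(σⁱ)² for i = 0,…,n. Then the function G(z) := k⁰z − (R̃⁰/2)z² + Σ_{i=1}^n h^{i,b}(z, −R⁰z³) attains its supremum over (0,∞): there exists zᵇ > 0 with G(zᵇ) ≥ G(z) for every z > 0. (Existence of the optimal pay-for-performance rate zᵇ solving the maximisation problem (2.14) in Proposition 2.3.) -/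
/-- A continuous function squeezed between two concave parabolas which agree to first order
at `0`, with positive slope there, attains its maximum over `(0, ∞)`. -/
theorem exists_pos_forall_pos_le_of_parabola_bounds {F : ℝ → ℝ} (hF : Continuous F)
    {b C E : ℝ} (hb : 0 < b) (hC : 0 < C) (hE : 0 < E)
    (upper : ∀ z, 0 ≤ z → F z ≤ F 0 + b * z - C * z ^ 2)
    (lower : ∀ z, 0 ≤ z → F 0 + b * z - E * z ^ 2 ≤ F z) :
    ∃ x, 0 < x ∧ ∀ z, 0 < z → F z ≤ F x := by
  have beyond : ∀ z, b / C ≤ z → F z ≤ F 0 := by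
    intro z hz
    have hz0 : 0 < z := (div_pos hb hC).trans_le hz
    have hbz : b ≤ z * C := (div_le_iff₀ hC).1 hz
    nlinarith [upper z hz0.le]
  obtain ⟨y, hy, hFy⟩ : ∃ y, 0 < y ∧ F 0 < F y := by
    refine ⟨b / (2 * E), by positivity, ?_⟩
    have hgain : b * (b / (2 * E)) - E * (b / (2 * E)) ^ 2 = b ^ 2 / (4 * E) := by
      field_simp
      ring
    have hpos : 0 < b ^ 2 / (4 * E) := by positivity
    linarith [lower (b / (2 * E)) (by positivity)]
  obtain ⟨x, hx, hmax⟩ := (isCompact_Icc (a := 0) (b := b / C)).exists_isMaxOn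
    (Set.nonempty_Icc.2 (by positivity)) hF.continuousOn
  have hyx : F y ≤ F x := by
    rcases le_total y (b / C) with h | h
    · exact hmax ⟨hy.le, h⟩
    · exact absurd (beyond y h) (not_le.2 hFy)
  refine ⟨x, hx.1.lt_of_ne ?_, fun z hz => ?_⟩
  · rintro rfl
    exact absurd hyx (not_le.2 hFy)
  · rcases le_total z (b / C) with h | h
    · exact hmax ⟨hz.le, h⟩
    · exact (beyond z h).trans (hFy.le.trans hyx)

/-- The maximum over `p` of `a * p - (a + r) / 2 * p ^ 2 - w / 2 * (1 - p) ^ 2`. -/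
noncomputable def optimalValue (a r w : ℝ) : ℝ :=
  (a ^ 2 + (a - r) * w) / (2 * (a + r + w))

theorem optimalValue_eq {a r w : ℝ} (h : a + r + w ≠ 0) :
    a * ((a + w) / (a + r + w)) - (a + r) / 2 * ((a + w) / (a + r + w)) ^ 2
      - w / 2 * (1 - (a + w) / (a + r + w)) ^ 2 = optimalValue a r w := by
  unfold optimalValue
  field_simp
  ring

theorem optimalValue_le {a r w : ℝ} (ha : 0 < a) (hr : 0 < r) (hw : 0 ≤ w) :
    optimalValue a r w ≤ optimalValue a r 0 := by
  unfold optimalValue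
  rw [div_le_div_iff₀ (by positivity) (by positivity)]
  nlinarith [mul_nonneg hw (sq_nonneg r)]

theorem le_optimalValue {a r w : ℝ} (ha : 0 < a) (hr : 0 < r) (hw : 0 ≤ w) :
    optimalValue a r 0 - w / 2 ≤ optimalValue a r w := by
  have hdiff : optimalValue a r w - (optimalValue a r 0 - w / 2)
      = w * (a * (a + 2 * r) + (a + r) * w) / (2 * (a + r) * (a + r + w)) := by
    have : a + r ≠ 0 := by positivity
    have : a + r + w ≠ 0 := by positivity
    unfold optimalValue
    rw [add_zero]
    field_simp
    ring
  have : 0 ≤ w * (a * (a + 2 * r) + (a + r) * w) / (2 * (a + r) * (a + r + w)) := by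
    positivity
  linarith

/-- Existence of the optimal pay-for-performance rate `zᵇ` solving the maximisation
problem (2.14) in Proposition 2.3: the function
`G(z) = k⁰z − (R̃⁰/2)z² + Σᵢ h^{i,b}(z, −R⁰z³)` attains its supremum over `(0,∞)`. -/
theorem exists_optimal_pps
    (n : ℕ) (hn : 1 ≤ n) (k0 R0 σ0 : ℝ)
    (hk0 : 0 < k0) (hR0 : 0 < R0) (hσ0 : 0 < σ0)
    (k R σ : Fin n → ℝ)
    (hk : ∀ i, 0 < k i) (hR : ∀ i, 0 < R i) (hσ : ∀ i, 0 < σ i)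
    (zib : ℝ → ℝ → Fin n → ℝ)
    (hzib : ∀ zz g i, zib zz g i = (k i * zz - (σ i) ^ 2 * g)
        / ((k i + R i * (σ i) ^ 2) * zz - (σ i) ^ 2 * g))
    (hib : ℝ → ℝ → Fin n → ℝ)
    (hhib : ∀ zz g i, hib zz g i = k i * zib zz g i
        - (k i + R i * (σ i) ^ 2) / 2 * (zib zz g i) ^ 2
        - R0 / 2 * (σ i) ^ 2 * zz ^ 2 * (1 - zib zz g i) ^ 2)
    (G : ℝ → ℝ)
    (hG : ∀ z, G z = k0 * z - (k0 + R0 * σ0 ^ 2) / 2 * z ^ 2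
        + ∑ i, hib z (-R0 * z ^ 3) i) :
    ∃ zb : ℝ, 0 < zb ∧ ∀ z : ℝ, 0 < z → G z ≤ G zb := by
  have hr : ∀ i, 0 < R i * σ i ^ 2 := fun i => mul_pos (hR i) (pow_pos (hσ i) 2)
  have hw : ∀ i (z : ℝ), 0 ≤ σ i ^ 2 * R0 * z ^ 2 := fun i z => by positivity
  have hden : ∀ i (z : ℝ), 0 < k i + R i * σ i ^ 2 + σ i ^ 2 * R0 * z ^ 2 := fun i z =>
    add_pos_of_pos_of_nonneg (add_pos (hk i) (hr i)) (hw i z)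
  -- `F` extends `G` continuously to `0`, where `G` involves a division by zero.
  let F : ℝ → ℝ := fun z => k0 * z - (k0 + R0 * σ0 ^ 2) / 2 * z ^ 2
    + ∑ i, optimalValue (k i) (R i * σ i ^ 2) (σ i ^ 2 * R0 * z ^ 2)
  have hGF : ∀ z, 0 < z → G z = F z := by
    intro z hz
    rw [hG]
    refine congrArg _ (Finset.sum_congr rfl fun i _ => ?_)
    have hp : zib z (-R0 * z ^ 3) i = (k i + σ i ^ 2 * R0 * z ^ 2)
        / (k i + R i * σ i ^ 2 + σ i ^ 2 * R0 * z ^ 2) := by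
      rw [hzib, ← mul_div_mul_right (k i + _) _ hz.ne']
      congr 1 <;> ring
    rw [hhib, hp, ← optimalValue_eq (hden i z).ne']
    ring
  have hF : Continuous F := by
    refine Continuous.add (by fun_prop) (continuous_finsetSum _ fun i _ => ?_)
    unfold optimalValue
    exact Continuous.div (by fun_prop) (by fun_prop)
      fun z => mul_ne_zero two_ne_zero (hden i z).ne'
  have hF0 : F 0 = ∑ i, optimalValue (k i) (R i * σ i ^ 2) 0 := by simp [F]
  have hD : 0 ≤ ∑ i, σ i ^ 2 * R0 / 2 := Finset.sum_nonneg fun i _ => by positivity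
  obtain ⟨x, hx, hmax⟩ := exists_pos_forall_pos_le_of_parabola_bounds hF hk0
    (C := (k0 + R0 * σ0 ^ 2) / 2) (E := (k0 + R0 * σ0 ^ 2) / 2 + ∑ i, σ i ^ 2 * R0 / 2)
    (by positivity) (by positivity)
    (fun z _ => by
      have := Finset.sum_le_sum fun i (_ : i ∈ Finset.univ) =>
        optimalValue_le (hk i) (hr i) (hw i z)
      rw [hF0]
      simp only [F]
      linarith)
    (fun z _ => by
      have hsum := Finset.sum_le_sum fun i (_ : i ∈ Finset.univ) =>
        le_optimalValue (hk i) (hr i) (hw i z)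
      have hfactor : ∑ i, σ i ^ 2 * R0 * z ^ 2 / 2 = (∑ i, σ i ^ 2 * R0 / 2) * z ^ 2 := by
        rw [Finset.sum_mul]
        exact Finset.sum_congr rfl fun i _ => by ring
      rw [Finset.sum_sub_distrib, hfactor] at hsum
      rw [hF0]
      simp only [F]
      linarith)
  exact ⟨x, hx, fun z hz => by rw [hGF z hz, hGF x hx]; exact hmax z hz⟩
end

section
/- Let k, R, σ, R⁰ be positive reals and R̃ := k + Rσ². For every (z,γ) ∈ ℝ² with R̃z − σ²γ > 0, setting w := (kz − σ²γ)/(R̃z − σ²γ), one has kw − (R̃/2)w² − (R⁰/2)σ²z²(1 − w)² < k²/(2R̃). (Each agent's contribution to the principal's objective in the hierarchical case is strictly below the direct-contracting per-agent value kⁱ²/(2R̃ⁱ).) -/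
/-- Each agent's contribution to the principal's objective in the hierarchical case is
strictly below the direct-contracting per-agent value `k²/(2R̃)`: for every `(z,γ)` with
`R̃z − σ²γ > 0` and `w = (kz − σ²γ)/(R̃z − σ²γ)`, one has
`kw − (R̃/2)w² − (R⁰/2)σ²z²(1 − w)² < k²/(2R̃)`. -/
theorem agent_contribution_below_DC
    (k R σ R0 : ℝ) (hk : 0 < k) (hR : 0 < R) (hσ : 0 < σ) (hR0 : 0 < R0) :
    ∀ z γ : ℝ, (k + R * σ ^ 2) * z - σ ^ 2 * γ > 0 →
      ∀ w : ℝ, w = (k * z - σ ^ 2 * γ) / ((k + R * σ ^ 2) * z - σ ^ 2 * γ) →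
        k * w - (k + R * σ ^ 2) / 2 * w ^ 2 - R0 / 2 * σ ^ 2 * z ^ 2 * (1 - w) ^ 2
          < k ^ 2 / (2 * (k + R * σ ^ 2)) := by
  intro z γ hD w hw
  set T := k + R * σ ^ 2 with hT
  have hRσ : 0 < R * σ ^ 2 := by positivity
  have hTpos : 0 < T := by positivity
  -- Completing the square in `w`.
  have gap : k ^ 2 / (2 * T)
      - (k * w - T / 2 * w ^ 2 - R0 / 2 * σ ^ 2 * z ^ 2 * (1 - w) ^ 2)
      = (T * w - k) ^ 2 / (2 * T) + R0 / 2 * σ ^ 2 * (z * (1 - w)) ^ 2 := by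
    field_simp
    ring
  have one_sub_w : (1 - w) * (T * z - σ ^ 2 * γ) = R * σ ^ 2 * z := by
    have hwD : w * (T * z - σ ^ 2 * γ) = k * z - σ ^ 2 * γ := by
      rw [hw, div_mul_cancel₀ _ hD.ne']
    rw [sub_mul, hwD, hT]
    ring
  rw [← sub_pos, gap]
  rcases eq_or_ne z 0 with hz | hz
  · have hw1 : 1 - w = 0 := by
      refine (mul_eq_zero.mp (one_sub_w.trans ?_)).resolve_right hD.ne'
      rw [hz, mul_zero]
    have hne : T * w - k ≠ 0 := by
      rw [← sub_eq_zero.mp hw1, mul_one, hT, add_sub_cancel_left]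
      exact hRσ.ne'
    positivity
  · have hw1 : 1 - w ≠ 0 := left_ne_zero_of_mul (one_sub_w ▸ mul_ne_zero hRσ.ne' hz)
    positivity
end

section
/- Fix an integer n ≥ 1 and positive reals k⁰, R⁰, σ⁰ and kⁱ, Rⁱ, σⁱ (i = 1,…,n), with R̃ⁱ := kⁱ + Rⁱ(σⁱ)² for i = 0,…,n. For every (z,γ) ∈ ℝ² with R̃ⁱz − (σⁱ)²γ > 0 for all i = 1,…,n, one has k⁰z − (R̃⁰/2)z² + Σ_{i=1}^n h^{i,b}(z,γ) < V^{DC} := (1/2)Σ_{i=0}^n (kⁱ)²/R̃ⁱ. (Hierarchical contracting without managerial ability yields a principal's objective strictly below the direct-contracting value, for every admissible choice of payment rates.) -/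
/-- The concave quadratic `k x - (r / 2) x ^ 2` is bounded by its maximum `k ^ 2 / (2 r)`. -/
lemma linear_sub_sq_le {k r : ℝ} (hr : 0 < r) (x : ℝ) :
    k * x - r / 2 * x ^ 2 ≤ 1 / 2 * (k ^ 2 / r) := by
  have h : 1 / 2 * (k ^ 2 / r) - (k * x - r / 2 * x ^ 2) = (r * x - k) ^ 2 / (2 * r) := by
    field_simp
    ring
  have : 0 ≤ (r * x - k) ^ 2 / (2 * r) := by positivity
  linarith

/-- The maximum of `k x - (r / 2) x ^ 2` is attained only at `x = k / r`. -/
lemma linear_sub_sq_lt {k r x : ℝ} (hr : 0 < r) (hx : r * x ≠ k) :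
    k * x - r / 2 * x ^ 2 < 1 / 2 * (k ^ 2 / r) := by
  have h : 1 / 2 * (k ^ 2 / r) - (k * x - r / 2 * x ^ 2) = (r * x - k) ^ 2 / (2 * r) := by
    field_simp
    ring
  have hne : r * x - k ≠ 0 := sub_ne_zero.mpr hx
  have : 0 < (r * x - k) ^ 2 / (2 * r) := by positivity
  linarith

/-- Hierarchical contracting without managerial ability yields a principal's objective
strictly below the direct-contracting value: for every admissible `(z,γ)`,
`k⁰z − (R̃⁰/2)z² + Σᵢ h^{i,b}(z,γ) < V^{DC} = (1/2)Σ_{i=0}^n (kⁱ)²/R̃ⁱ`. -/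
theorem hierarchical_below_direct_contracting
    (n : ℕ) (hn : 1 ≤ n) (k0 R0 σ0 : ℝ)
    (hk0 : 0 < k0) (hR0 : 0 < R0) (hσ0 : 0 < σ0)
    (k R σ : Fin n → ℝ)
    (hk : ∀ i, 0 < k i) (hR : ∀ i, 0 < R i) (hσ : ∀ i, 0 < σ i)
    (zib : ℝ → ℝ → Fin n → ℝ)
    (hzib : ∀ zz g i, zib zz g i = (k i * zz - (σ i) ^ 2 * g)
        / ((k i + R i * (σ i) ^ 2) * zz - (σ i) ^ 2 * g))
    (hib : ℝ → ℝ → Fin n → ℝ)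
    (hhib : ∀ zz g i, hib zz g i = k i * zib zz g i
        - (k i + R i * (σ i) ^ 2) / 2 * (zib zz g i) ^ 2
        - R0 / 2 * (σ i) ^ 2 * zz ^ 2 * (1 - zib zz g i) ^ 2) :
    ∀ z γ : ℝ, (∀ i, (k i + R i * (σ i) ^ 2) * z - (σ i) ^ 2 * γ > 0) →
      k0 * z - (k0 + R0 * σ0 ^ 2) / 2 * z ^ 2 + ∑ i, hib z γ i
        < (1 / 2) * (k0 ^ 2 / (k0 + R0 * σ0 ^ 2)
            + ∑ i, (k i) ^ 2 / (k i + R i * (σ i) ^ 2)) := by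
  intro z γ _
  have hr0 : 0 < k0 + R0 * σ0 ^ 2 := by positivity
  have hr : ∀ i, 0 < k i + R i * σ i ^ 2 := fun i => by
    have := hk i
    have := hR i
    have := hσ i
    positivity
  have hpen : ∀ i, 0 ≤ R0 / 2 * σ i ^ 2 * z ^ 2 * (1 - zib z γ i) ^ 2 := fun i => by positivity
  have hle : ∀ i, hib z γ i ≤ 1 / 2 * (k i ^ 2 / (k i + R i * σ i ^ 2)) := fun i => by
    rw [hhib]
    linarith [linear_sub_sq_le (k := k i) (hr i) (zib z γ i), hpen i]
  rw [mul_add, Finset.mul_sum]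
  rcases eq_or_ne z 0 with rfl | hz
  · exact add_lt_add_of_lt_of_le (linear_sub_sq_lt hr0 (by simpa using hk0.ne))
      (Finset.sum_le_sum fun i _ => hle i)
  · refine add_lt_add_of_le_of_lt (linear_sub_sq_le hr0 z)
      (Finset.sum_lt_sum (fun i _ => hle i) ⟨⟨0, hn⟩, Finset.mem_univ _, ?_⟩)
    generalize (⟨0, hn⟩ : Fin n) = i
    rw [hhib]
    by_cases hx : (k i + R i * σ i ^ 2) * zib z γ i = k i
    · have hσi := hσ i
      have hRσ : 0 < R i * σ i ^ 2 := mul_pos (hR i) (by positivity)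
      have hne : 1 - zib z γ i ≠ 0 := fun h => by
        rw [← sub_eq_zero.mp h] at hx
        linarith
      have hpos : 0 < R0 / 2 * σ i ^ 2 * z ^ 2 * (1 - zib z γ i) ^ 2 := by positivity
      linarith [linear_sub_sq_le (k := k i) (hr i) (zib z γ i)]
    · linarith [linear_sub_sq_lt (hr i) hx, hpen i]
end

section
/- Fix an integer n ≥ 1 and positive reals k⁰, R⁰, σ⁰ and kⁱ, Rⁱ, σⁱ (i = 1,…,n), with R̃ⁱ := kⁱ + Rⁱ(σⁱ)² for i = 0,…,n. Let 𝕍ᵇ := {(z,γ) ∈ ℝ² : R̃ⁱz − (σⁱ)²γ > 0 for all i = 1,…,n}. Then: (a) V^{DC} := (1/2)Σ_{i=0}^n (kⁱ)²/R̃ⁱ is the least upper bound of the set { k⁰w − (R̃⁰/2)w² + Σ_{i=1}^n h^{i,b}(z,γ) : w ∈ ℝ, (z,γ) ∈ 𝕍ᵇ }, and (b) this least upper bound is not attained: the value is strictly below V^{DC} at every point. (Proposition 3.4(i): when the manager reports his own outcome separately, there is a sequence of contracts whose values converge to the direct-contracting value V^{DC}, but no contract attains it.) -/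
open Filter Topology in
/-- A constant bounding `a - C * z ^ 2` for all `z > 0` bounds `a`. -/
lemma le_of_forall_pos_sub_mul_sq_le {a b C : ℝ} (h : ∀ z > 0, a - C * z ^ 2 ≤ b) : a ≤ b := by
  have hc : Continuous fun z : ℝ => a - C * z ^ 2 := by fun_prop
  have ht : Tendsto (fun z : ℝ => a - C * z ^ 2) (𝓝[>] 0) (𝓝 a) := by
    simpa using (hc.tendsto 0).mono_left nhdsWithin_le_nhds
  exact le_of_tendsto ht (eventually_mem_nhdsWithin.mono h)

lemma mul_sub_half_mul_sq (k x : ℝ) {r : ℝ} (hr : r ≠ 0) :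
    k * x - r / 2 * x ^ 2 = 1 / 2 * (k ^ 2 / r) - r / 2 * (x - k / r) ^ 2 := by
  field_simp
  ring

/-- The reduced objective on one agent lies strictly below the direct-contracting value. -/
lemma agent_objective_lt {k R σ R0 z g : ℝ} (hk : 0 < k) (hR : 0 < R) (hσ : 0 < σ)
    (hR0 : 0 < R0) (hD : 0 < (k + R * σ ^ 2) * z - σ ^ 2 * g) {x : ℝ}
    (hx : x = (k * z - σ ^ 2 * g) / ((k + R * σ ^ 2) * z - σ ^ 2 * g)) :
    k * x - (k + R * σ ^ 2) / 2 * x ^ 2 - R0 / 2 * σ ^ 2 * z ^ 2 * (1 - x) ^ 2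
      < 1 / 2 * (k ^ 2 / (k + R * σ ^ 2)) := by
  have hr : 0 < k + R * σ ^ 2 := by positivity
  rw [mul_sub_half_mul_sq k x hr.ne']
  by_cases hz : z = 0
  · subst hz
    have hx1 : x = 1 := by
      rw [hx]
      simp only [mul_zero] at hD ⊢
      exact div_self hD.ne'
    have hkr : 0 < 1 - k / (k + R * σ ^ 2) := by
      rw [sub_pos, div_lt_one hr]
      exact lt_add_of_pos_right k (by positivity)
    have hpos : 0 < (k + R * σ ^ 2) / 2 * (1 - k / (k + R * σ ^ 2)) ^ 2 := by positivity
    rw [hx1]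
    linarith
  · have h1x : 1 - x = R * σ ^ 2 * z / ((k + R * σ ^ 2) * z - σ ^ 2 * g) := by
      rw [hx, eq_div_iff hD.ne', sub_mul, div_mul_cancel₀ _ hD.ne']
      ring
    have hx1 : 1 - x ≠ 0 := by
      rw [h1x]
      exact div_ne_zero (by positivity) hD.ne'
    have hpos : 0 < R0 / 2 * σ ^ 2 * z ^ 2 * (1 - x) ^ 2 := by positivity
    have hsq : 0 ≤ (k + R * σ ^ 2) / 2 * (x - k / (k + R * σ ^ 2)) ^ 2 := by positivity
    linarith

/-- Proposition 3.4(i): with separate reporting of the manager's outcome, the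
direct-contracting value `V^{DC}` is the least upper bound of the attainable values
`k⁰w − (R̃⁰/2)w² + Σᵢ h^{i,b}(z,γ)` over `w ∈ ℝ` and `(z,γ) ∈ 𝕍ᵇ`, and this least
upper bound is not attained: the value is strictly below `V^{DC}` at every point. -/
theorem separate_reporting_degenerates_to_DC
    (n : ℕ) (hn : 1 ≤ n) (k0 R0 σ0 : ℝ)
    (hk0 : 0 < k0) (hR0 : 0 < R0) (hσ0 : 0 < σ0)
    (k R σ : Fin n → ℝ)
    (hk : ∀ i, 0 < k i) (hR : ∀ i, 0 < R i) (hσ : ∀ i, 0 < σ i)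
    (zib : ℝ → ℝ → Fin n → ℝ)
    (hzib : ∀ zz g i, zib zz g i = (k i * zz - (σ i) ^ 2 * g)
        / ((k i + R i * (σ i) ^ 2) * zz - (σ i) ^ 2 * g))
    (hib : ℝ → ℝ → Fin n → ℝ)
    (hhib : ∀ zz g i, hib zz g i = k i * zib zz g i
        - (k i + R i * (σ i) ^ 2) / 2 * (zib zz g i) ^ 2
        - R0 / 2 * (σ i) ^ 2 * zz ^ 2 * (1 - zib zz g i) ^ 2)
    (VDC : ℝ)
    (hVDC : VDC = (1 / 2) * (k0 ^ 2 / (k0 + R0 * σ0 ^ 2)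
        + ∑ i, (k i) ^ 2 / (k i + R i * (σ i) ^ 2)))
    (S : Set ℝ)
    (hS : S = {y : ℝ | ∃ w z γ : ℝ,
        (∀ i, (k i + R i * (σ i) ^ 2) * z - (σ i) ^ 2 * γ > 0)
        ∧ y = k0 * w - (k0 + R0 * σ0 ^ 2) / 2 * w ^ 2 + ∑ i, hib z γ i}) :
    IsLUB S VDC
    ∧ ∀ w z γ : ℝ, (∀ i, (k i + R i * (σ i) ^ 2) * z - (σ i) ^ 2 * γ > 0) →
        k0 * w - (k0 + R0 * σ0 ^ 2) / 2 * w ^ 2 + ∑ i, hib z γ i < VDC := by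
  have hr0 : 0 < k0 + R0 * σ0 ^ 2 := by positivity
  have hr : ∀ i, 0 < k i + R i * σ i ^ 2 := fun i => by
    have := hk i
    have := hR i
    have := hσ i
    positivity
  have hlt : ∀ w z γ : ℝ, (∀ i, (k i + R i * (σ i) ^ 2) * z - (σ i) ^ 2 * γ > 0) →
      k0 * w - (k0 + R0 * σ0 ^ 2) / 2 * w ^ 2 + ∑ i, hib z γ i < VDC := by
    intro w z γ hD
    have hne : (Finset.univ : Finset (Fin n)).Nonempty := ⟨⟨0, hn⟩, Finset.mem_univ _⟩
    have hsum : ∑ i, hib z γ i < ∑ i, 1 / 2 * (k i ^ 2 / (k i + R i * σ i ^ 2)) :=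
      Finset.sum_lt_sum_of_nonempty hne fun i _ => by
        rw [hhib]
        exact agent_objective_lt (hk i) (hR i) (hσ i) hR0 (hD i) (hzib z γ i)
    have hsq : 0 ≤ (k0 + R0 * σ0 ^ 2) / 2 * (w - k0 / (k0 + R0 * σ0 ^ 2)) ^ 2 := by positivity
    rw [← Finset.mul_sum] at hsum
    rw [hVDC, mul_sub_half_mul_sq k0 w hr0.ne']
    linarith
  refine ⟨⟨?_, ?_⟩, hlt⟩
  · rw [hS]
    rintro y ⟨w, z, γ, hD, rfl⟩
    exact (hlt w z γ hD).le
  · intro b hb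
    refine le_of_forall_pos_sub_mul_sq_le
      (C := ∑ i, R0 / 2 * σ i ^ 2 * (1 - k i / (k i + R i * σ i ^ 2)) ^ 2) fun z hz => hb ?_
    rw [hS]
    refine ⟨k0 / (k0 + R0 * σ0 ^ 2), z, 0, fun i => ?_, ?_⟩
    · simpa using mul_pos (hr i) hz
    · have hz0 : ∀ i, zib z 0 i = k i / (k i + R i * σ i ^ 2) := fun i => by
        rw [hzib, mul_zero, sub_zero, sub_zero, mul_div_mul_right _ _ hz.ne']
      have hh : ∀ i, hib z 0 i = 1 / 2 * (k i ^ 2 / (k i + R i * σ i ^ 2))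
          - R0 / 2 * σ i ^ 2 * (1 - k i / (k i + R i * σ i ^ 2)) ^ 2 * z ^ 2 := fun i => by
        rw [hhib, hz0, mul_sub_half_mul_sq _ _ (hr i).ne']
        ring
      rw [hVDC, mul_sub_half_mul_sq _ _ hr0.ne', Finset.sum_congr rfl fun i _ => hh i,
        Finset.sum_sub_distrib, ← Finset.mul_sum, ← Finset.sum_mul]
      ring
end

section
/- Let k, R, σ be positive reals and R̃ := k + Rσ². For every z > 0 and every γ < 0 (so that R̃z − σ²γ > 0), the optimal agent payment rate satisfies k/R̃ < (kz − σ²γ)/(R̃z − σ²γ) < 1. In particular, for z > 0 and the principal's optimal choice γ = −R⁰z³ with R⁰ > 0, the agent's pay-for-performance sensitivity lies strictly between the direct-contracting sensitivity k/R̃ and 1. (Agents are induced to work harder than in the direct-contracting case, Section 2.3.2.) -/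
/-- Agents are induced to work harder than in the direct-contracting case
(Section 2.3.2): for every `z > 0` and `γ < 0`, the optimal agent payment rate
`(kz − σ²γ)/(R̃z − σ²γ)` lies strictly between `k/R̃` and `1`; in particular this holds
for the principal's optimal choice `γ = −R⁰z³` with `R⁰ > 0`. -/
theorem agent_pps_between_DC_and_one
    (k R σ R0 : ℝ) (hk : 0 < k) (hR : 0 < R) (hσ : 0 < σ) (hR0 : 0 < R0) :
    (∀ z γ : ℝ, 0 < z → γ < 0 →
      k / (k + R * σ ^ 2)
          < (k * z - σ ^ 2 * γ) / ((k + R * σ ^ 2) * z - σ ^ 2 * γ)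
      ∧ (k * z - σ ^ 2 * γ) / ((k + R * σ ^ 2) * z - σ ^ 2 * γ) < 1)
    ∧ ∀ z : ℝ, 0 < z →
      k / (k + R * σ ^ 2)
          < (k * z - σ ^ 2 * (-R0 * z ^ 3))
            / ((k + R * σ ^ 2) * z - σ ^ 2 * (-R0 * z ^ 3))
      ∧ (k * z - σ ^ 2 * (-R0 * z ^ 3))
            / ((k + R * σ ^ 2) * z - σ ^ 2 * (-R0 * z ^ 3)) < 1 := by
  have between : ∀ z γ : ℝ, 0 < z → γ < 0 →
      k / (k + R * σ ^ 2)
          < (k * z - σ ^ 2 * γ) / ((k + R * σ ^ 2) * z - σ ^ 2 * γ)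
      ∧ (k * z - σ ^ 2 * γ) / ((k + R * σ ^ 2) * z - σ ^ 2 * γ) < 1 := by
    intro z γ hz hγ
    have hRσ : 0 < R * σ ^ 2 := by positivity
    have hσγ : σ ^ 2 * γ < 0 := mul_neg_of_pos_of_neg (by positivity) hγ
    have hRσz : 0 < R * σ ^ 2 * z := mul_pos hRσ hz
    have hkz : 0 < k * z := mul_pos hk hz
    have hden : 0 < (k + R * σ ^ 2) * z - σ ^ 2 * γ := by linarith
    constructor
    · rw [div_lt_div_iff₀ (by positivity) hden]
      linarith [mul_neg_of_pos_of_neg hRσ hσγ]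
    · rw [div_lt_one hden]
      linarith
  refine ⟨between, fun z hz => between z _ hz ?_⟩
  exact mul_neg_of_neg_of_pos (neg_neg_of_pos hR0) (by positivity)
end

section
/- Let n ≥ 1 be an integer and k⁰, R⁰, σ⁰, k, R, σ be positive reals; set R̃⁰ := k⁰ + R⁰(σ⁰)² and R̃ := k + Rσ². For (z¹,z²,γ¹²,γ²²) ∈ ℝ⁴ with R̃z² + σ²γ²² ≠ 0, define w := −(kz¹ + σ²γ¹²)/(R̃z² + σ²γ²²) and Φ := k⁰z¹ − (R̃⁰/2)(z¹)² + n·[ kw − (R̃/2)w² − (R⁰/2)σ²(z¹ + z²w)² ]. Then for every γ²² < −k⁰R̃²/(kσ²R̃⁰), the choice z¹ = k⁰/R̃⁰, z² = −k⁰R̃/(kR̃⁰), γ¹² = (k⁰/R̃⁰)R − (k/R̃)γ²² satisfies R̃z² + σ²γ²² < 0, w = k/R̃, z¹ + z²w = 0, and Φ = (1/2)((k⁰)²/R̃⁰ + n·k²/R̃). (Proposition 3.3: with identical agents and reporting of profits and costs, the principal can achieve her direct-contracting utility.) -/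
/-- Proposition 3.3: with `n` identical agents and reporting of profits and costs,
for every `γ²² < −k⁰R̃²/(kσ²R̃⁰)` the choice `z¹ = k⁰/R̃⁰`, `z² = −k⁰R̃/(kR̃⁰)`,
`γ¹² = (k⁰/R̃⁰)R − (k/R̃)γ²²` is admissible (`R̃z² + σ²γ²² < 0`), induces the
direct-contracting agent rate `w = k/R̃` with `z¹ + z²w = 0`, and achieves the
direct-contracting value `(1/2)((k⁰)²/R̃⁰ + n·k²/R̃)`. -/
theorem pc_reporting_identical_agents_achieves_DC
    (n : ℕ) (hn : 1 ≤ n) (k0 R0 σ0 k R σ : ℝ)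
    (hk0 : 0 < k0) (hR0 : 0 < R0) (hσ0 : 0 < σ0)
    (hk : 0 < k) (hR : 0 < R) (hσ : 0 < σ) :
    ∀ γ22 z1 z2 γ12 w : ℝ,
      γ22 < -(k0 * (k + R * σ ^ 2) ^ 2) / (k * σ ^ 2 * (k0 + R0 * σ0 ^ 2)) →
      z1 = k0 / (k0 + R0 * σ0 ^ 2) →
      z2 = -(k0 * (k + R * σ ^ 2)) / (k * (k0 + R0 * σ0 ^ 2)) →
      γ12 = (k0 / (k0 + R0 * σ0 ^ 2)) * R - (k / (k + R * σ ^ 2)) * γ22 →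
      w = -(k * z1 + σ ^ 2 * γ12) / ((k + R * σ ^ 2) * z2 + σ ^ 2 * γ22) →
      ((k + R * σ ^ 2) * z2 + σ ^ 2 * γ22 < 0
      ∧ w = k / (k + R * σ ^ 2)
      ∧ z1 + z2 * w = 0
      ∧ k0 * z1 - (k0 + R0 * σ0 ^ 2) / 2 * z1 ^ 2
          + (n : ℝ) * (k * w - (k + R * σ ^ 2) / 2 * w ^ 2
              - R0 / 2 * σ ^ 2 * (z1 + z2 * w) ^ 2)
        = (1 / 2) * (k0 ^ 2 / (k0 + R0 * σ0 ^ 2)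
            + (n : ℝ) * k ^ 2 / (k + R * σ ^ 2))) := by
  intro γ22 z1 z2 γ12 w hγ hz1 hz2 hγ12 hw
  have hA : 0 < k0 + R0 * σ0 ^ 2 := by positivity
  have hB : 0 < k + R * σ ^ 2 := by positivity
  have hz2_neg : z2 < 0 := by
    rw [hz2]
    exact div_neg_of_neg_of_pos (neg_lt_zero.mpr (by positivity)) (by positivity)
  have hγ_neg : γ22 < 0 :=
    hγ.trans (div_neg_of_neg_of_pos (neg_lt_zero.mpr (by positivity)) (by positivity))
  have hden : (k + R * σ ^ 2) * z2 + σ ^ 2 * γ22 < 0 :=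
    add_neg (mul_neg_of_pos_of_neg hB hz2_neg) (mul_neg_of_pos_of_neg (by positivity) hγ_neg)
  have hw_eq : w = k / (k + R * σ ^ 2) := by
    rw [hw, div_eq_div_iff hden.ne hB.ne', hγ12, hz1, hz2]
    generalize k0 + R0 * σ0 ^ 2 = A at hA ⊢
    field_simp
    ring
  have hcancel : z1 + z2 * w = 0 := by
    rw [hw_eq, hz1, hz2]
    field_simp
    ring
  refine ⟨hden, hw_eq, hcancel, ?_⟩
  rw [hcancel, hw_eq, hz1]
  field_simp
  ring
end

section
/- Fix an integer n ≥ 1 (the number of agents in team j), positive reals k, R, σ (the team manager's parameters), positive reals kᵢ, Rᵢ, σᵢ for i = 1,…,n with R̃ᵢ := kᵢ + Rᵢσᵢ², and set R̃ := k + Rσ². Let z > 0, γ ∈ ℝ (the principal's rates), and let s ∈ ℝ, s ≠ 0 (the fixed rate zʲ for the team manager). For g ∈ ℝ with Dᵢ(g) := R̃ᵢs − σᵢ²g > 0 for all i, define wᵢ(g) := (kᵢs − σᵢ²g)/Dᵢ(g) and Φ(g) := z·( ks − (R̃/2)s² + Σ_{i=1}^n [ kᵢwᵢ(g) − (R̃ᵢ/2)wᵢ(g)²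 − (R/2)s²σᵢ²(1 − wᵢ(g))² ] ) + (γ/2)(1 − s)²( σ² + Σ_{i=1}^n σᵢ²(1 − wᵢ(g))² ). Then Φ is differentiable at every such g with Φ'(g) = −s·( z(g + Rs³) − γs(1 − s)² )·Σ_{i=1}^n Rᵢ²σᵢ⁸/Dᵢ(g)³; in particular Φ'(g) = 0 if and only if g = −Rs³ + (γ/z)s(1 − s)². (First-order condition of Section 3.3 characterising the top manager's optimal quadratic-variation rate γ^{j,⋆} = −Rʲ(zʲ)³ + (γ/z)zʲ(1 − zʲ)² in the three-level hierarchy.) -/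
/-- Derivative of the agent rate `(a s - v g) / ((a + r v) s - v g)` in `g`. -/
theorem hasDerivAt_agent_rate (a r v s g : ℝ) (hD : (a + r * v) * s - v * g ≠ 0) :
    HasDerivAt (fun x => (a * s - v * x) / ((a + r * v) * s - v * x))
      (-(r * v ^ 2 * s) / ((a + r * v) * s - v * g) ^ 2) g := by
  have affine (c : ℝ) : HasDerivAt (fun x => c - v * x) (-v) g := by
    simpa using ((hasDerivAt_id g).const_mul v).const_sub c
  refine ((affine (a * s)).fun_div (affine ((a + r * v) * s)) hD).congr_deriv ?_
  ring

/-- First-order condition of Section 3.3 (three-level hierarchy): for team `j` with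
agent rates `wᵢ(g) = (kᵢs − σᵢ²g)/Dᵢ(g)`, `Dᵢ(g) = R̃ᵢs − σᵢ²g > 0`, the map
`Φ(g) = z·h^{0,j}(s,g) + (γ/2)(1−s)²(σ² + Σᵢσᵢ²(1−wᵢ(g))²)` is differentiable with
derivative `Φ'(g) = −s(z(g + Rs³) − γs(1−s)²)·Σᵢ Rᵢ²σᵢ⁸/Dᵢ(g)³`; in particular
`Φ'(g) = 0` iff `g = −Rs³ + (γ/z)s(1−s)²`. -/
theorem top_manager_first_order_condition
    (n : ℕ) (hn : 1 ≤ n) (k R σ : ℝ)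
    (hkM : 0 < k) (hRM : 0 < R) (hσM : 0 < σ)
    (ka Ra σa : Fin n → ℝ)
    (hka : ∀ i, 0 < ka i) (hRa : ∀ i, 0 < Ra i) (hσa : ∀ i, 0 < σa i)
    (z γ s : ℝ) (hz : 0 < z) (hs : s ≠ 0)
    (w : Fin n → ℝ → ℝ)
    (hw : ∀ i g, w i g = (ka i * s - (σa i) ^ 2 * g)
        / ((ka i + Ra i * (σa i) ^ 2) * s - (σa i) ^ 2 * g))
    (Φ : ℝ → ℝ)
    (hΦ : ∀ g, Φ g = z * (k * s - (k + R * σ ^ 2) / 2 * s ^ 2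
          + ∑ i, (ka i * w i g
              - (ka i + Ra i * (σa i) ^ 2) / 2 * (w i g) ^ 2
              - R / 2 * s ^ 2 * (σa i) ^ 2 * (1 - w i g) ^ 2))
        + γ / 2 * (1 - s) ^ 2
            * (σ ^ 2 + ∑ i, (σa i) ^ 2 * (1 - w i g) ^ 2)) :
    ∀ g : ℝ, (∀ i, (ka i + Ra i * (σa i) ^ 2) * s - (σa i) ^ 2 * g > 0) →
      HasDerivAt Φ
        (-s * (z * (g + R * s ^ 3) - γ * s * (1 - s) ^ 2)
          * ∑ i, (Ra i) ^ 2 * (σa i) ^ 8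
              / ((ka i + Ra i * (σa i) ^ 2) * s - (σa i) ^ 2 * g) ^ 3) g
      ∧ ((-s * (z * (g + R * s ^ 3) - γ * s * (1 - s) ^ 2)
          * ∑ i, (Ra i) ^ 2 * (σa i) ^ 8
              / ((ka i + Ra i * (σa i) ^ 2) * s - (σa i) ^ 2 * g) ^ 3) = 0
        ↔ g = -R * s ^ 3 + (γ / z) * s * (1 - s) ^ 2) := by
  intro g hD
  have hw_deriv (i : Fin n) : HasDerivAt (w i)
      (-(Ra i * ((σa i) ^ 2) ^ 2 * s)
        / ((ka i + Ra i * (σa i) ^ 2) * s - (σa i) ^ 2 * g) ^ 2) g := by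
    rw [funext (hw i)]
    exact hasDerivAt_agent_rate _ _ _ _ _ (hD i).ne'
  constructor
  · have h_team := HasDerivAt.fun_sum (u := Finset.univ) fun i _ =>
      (((hw_deriv i).const_mul (ka i)).fun_sub
        (((hw_deriv i).fun_pow 2).const_mul ((ka i + Ra i * (σa i) ^ 2) / 2))).fun_sub
        ((((hw_deriv i).const_sub 1).fun_pow 2).const_mul (R / 2 * s ^ 2 * (σa i) ^ 2))
    have h_var := HasDerivAt.fun_sum (u := Finset.univ) fun i _ =>
      (((hw_deriv i).const_sub 1).fun_pow 2).const_mul ((σa i) ^ 2)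
    rw [funext hΦ]
    refine (((h_team.const_add (k * s - (k + R * σ ^ 2) / 2 * s ^ 2)).const_mul z).fun_add
      ((h_var.const_add (σ ^ 2)).const_mul (γ / 2 * (1 - s) ^ 2))).congr_deriv ?_
    simp only [Finset.mul_sum, ← Finset.sum_add_distrib]
    refine Finset.sum_congr rfl fun i _ => ?_
    have hDi := (hD i).ne'
    rw [hw i g]
    generalize hDef : (ka i + Ra i * (σa i) ^ 2) * s - (σa i) ^ 2 * g = D at hDi ⊢
    push_cast
    field_simp
    rw [← hDef]
    ring
  · have : Nonempty (Fin n) := ⟨⟨0, hn⟩⟩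
    have h_sum : 0 < ∑ i, (Ra i) ^ 2 * (σa i) ^ 8
        / ((ka i + Ra i * (σa i) ^ 2) * s - (σa i) ^ 2 * g) ^ 3 :=
      Finset.sum_pos (fun i _ => div_pos (mul_pos (pow_pos (hRa i) 2) (pow_pos (hσa i) 8))
        (pow_pos (hD i) 3)) Finset.univ_nonempty
    rw [mul_eq_zero_iff_right h_sum.ne', mul_eq_zero_iff_left (neg_ne_zero.mpr hs)]
    have h_factor : z * (g + R * s ^ 3) - γ * s * (1 - s) ^ 2
        = z * (g - (-R * s ^ 3 + (γ / z) * s * (1 - s) ^ 2)) := by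
      field_simp
      ring
    rw [h_factor, mul_eq_zero_iff_left hz.ne', sub_eq_zero]
end
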